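/- arXiv:2308.07278 — 2 statements merged into one kernel-verified Lean document; each statement's English description precedes it below -/
import Mathlib

section
/- For every odd m ≥ 3 and even r ≥ 2, there exists an m×r quasi Kotzig array: an m×r array each row of which is a permutation of {1,…,r}, and each column sum of which equals (m(r+1)−1)/2 or (m(r+1)+1)/2. -/
open Finset

/-- The array, zero-based in both indices, with `r = 2 * k`. -/
def qkaEntry (k i j : ℕ) : ℕ :=
  if i = 0 then j + 1
  else if i = 1 then (if j < k then j + k + 1 else j - k + 1)
  else if i = 2 then (if j < k then 2 * k - 2 * j else 4 * k - 1 - 2 * j)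
  else if i % 2 = 1 then j + 1 else 2 * k - j

lemma qkaEntry_sum (k j n : ℕ) (hj : j < 2 * k) :
    2 * ∑ i ∈ Finset.range (2 * n + 3), qkaEntry k i j + (if j < k then 0 else 1)
      = (2 * n + 3) * (2 * k + 1) + (if j < k then 1 else 0) := by
  induction n with
  | zero =>
    by_cases h : j < k <;> simp [Finset.sum_range_succ, qkaEntry, h] <;> omega
  | succ n ih =>
    have e : 2 * (n + 1) + 3 = (2 * n + 3) + 1 + 1 := by ring
    have h1 : qkaEntry k (2 * n + 3) j = j + 1 := by
      unfold qkaEntry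
      rw [if_neg (by omega), if_neg (by omega), if_neg (by omega), if_pos (by omega)]
    have h2 : qkaEntry k (2 * n + 3 + 1) j = 2 * k - j := by
      unfold qkaEntry
      rw [if_neg (by omega), if_neg (by omega), if_neg (by omega), if_neg (by omega)]
    rw [e, Finset.sum_range_succ, Finset.sum_range_succ, h1, h2]
    have h3 : (2 * n + 3 + 1 + 1) * (2 * k + 1)
        = (2 * n + 3) * (2 * k + 1) + 2 * (2 * k + 1) := by ring
    rw [h3]
    omega

/-- For every odd `m ≥ 3` and even `r ≥ 2` there exists an `m × r` quasi Kotzig array: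
each row a permutation of `{1,…,r}` and each column sum equal to `(m(r+1)-1)/2` or
`(m(r+1)+1)/2`. -/
theorem stmt_8 (m r : ℕ) (hm : Odd m) (hm3 : 3 ≤ m) (hr : Even r) (hr2 : 2 ≤ r) :
    ∃ f : Fin m → Fin r → ℕ,
      (∀ i, Function.Injective (f i) ∧ ∀ j, f i j ∈ Finset.Icc 1 r) ∧
      (∀ j, 2 * ∑ i, f i j = m * (r + 1) - 1 ∨ 2 * ∑ i, f i j = m * (r + 1) + 1) := by
  obtain ⟨k, hk⟩ := hr
  obtain ⟨l, hl⟩ := hm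
  obtain ⟨n, rfl⟩ : ∃ n, m = 2 * n + 3 := ⟨l - 1, by omega⟩
  obtain rfl : r = 2 * k := by omega
  refine ⟨fun i j => qkaEntry k i j, fun i => ⟨fun a b hab => ?_, fun j => ?_⟩, fun j => ?_⟩
  · have ha := a.2
    have hb := b.2
    apply Fin.ext
    simp only [qkaEntry] at hab
    split_ifs at hab <;> omega
  · have hj := j.2
    rw [Finset.mem_Icc]
    simp only [qkaEntry]
    split_ifs <;> omega
  · have h := qkaEntry_sum k j n j.2
    rw [← Fin.sum_univ_eq_sum_range (fun i => qkaEntry k i j)] at h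
    split_ifs at h
    · right; simpa using h
    · left; simp only [] ; omega
end

section
/- If G is a disjoint union of r copies of K_{m,n} (m ≠ n, m,n > 1) and there exists a magic rectangle set MRS(m,n;r), then labeling the edges of the t-th copy by the t-th array (edge v_i u_j of copy t labeled with the (i,j) entry of the t-th array) is a local antimagic labeling inducing exactly 2 vertex weights; hence χ_la(rK_{m,n}) = 2 whenever m,n,r are all odd, or m,n are both even with (m,n) ≠ (2,2). -/
open Finset

/-- zero-sum array on `m × n` with entries whose absolute values are in `W`. -/
def ZR (m n : ℕ) (W : Set ℕ) : Prop :=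
  ∃ F : ℕ → ℕ → ℤ, (∀ i < m, ∀ j < n, (F i j).natAbs ∈ W) ∧
    (∀ i < m, ∀ j < n, ∀ i' < m, ∀ j' < n, F i j = F i' j' → i = i' ∧ j = j') ∧
    (∀ i < m, ∑ j ∈ range n, F i j = 0) ∧ (∀ j < n, ∑ i ∈ range m, F i j = 0)

lemma ZR.transp {m n : ℕ} {W : Set ℕ} (h : ZR m n W) : ZR n m W := by
  obtain ⟨F, h1, h2, h3, h4⟩ := h
  refine ⟨fun i j => F j i, fun i hi j hj => h1 j hj i hi, ?_, h4, h3⟩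
  intro i hi j hj i' hi' j' hj' h
  exact (h2 j hj i hi j' hj' i' hi' h).symm

lemma ZR.mono {m n : ℕ} {W W' : Set ℕ} (h : ZR m n W) (hW : W ⊆ W') : ZR m n W' := by
  obtain ⟨F, h1, h2, h3, h4⟩ := h
  exact ⟨F, fun i hi j hj => hW (h1 i hi j hj), h2, h3, h4⟩

lemma ZR.zero (n : ℕ) (W : Set ℕ) : ZR 0 n W :=
  ⟨fun _ _ => 0, by simp, by simp, by simp, by simp⟩

lemma ZR.vstack {m m' n : ℕ} {W W' : Set ℕ} (h : ZR m n W) (h' : ZR m' n W')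
    (hd : Disjoint W W') : ZR (m + m') n (W ∪ W') := by
  obtain ⟨F, h1, h2, h3, h4⟩ := h
  obtain ⟨G, g1, g2, g3, g4⟩ := h'
  have hd' := Set.disjoint_left.1 hd
  refine ⟨fun i j => if i < m then F i j else G (i - m) j, ?_, ?_, ?_, ?_⟩
  · intro i hi j hj
    by_cases him : i < m
    · simp only [him, if_true]; exact Or.inl (h1 i him j hj)
    · simp only [him, if_false]; exact Or.inr (g1 _ (by omega) j hj)
  · intro i hi j hj i' hi' j' hj' h
    by_cases him : i < m <;> by_cases him' : i' < m <;> simp only [him, him', if_true, if_false] at h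
    · exact h2 i him j hj i' him' j' hj' h
    · exact absurd (g1 (i' - m) (by omega) j' hj') (hd' (h ▸ h1 i him j hj))
    · exact absurd (g1 (i - m) (by omega) j hj) (hd' (h ▸ h1 i' him' j' hj'))
    · have := g2 (i - m) (by omega) j hj (i' - m) (by omega) j' hj' h
      omega
  · intro i hi
    by_cases him : i < m
    · simp only [him, if_true]; exact h3 i him
    · simp only [him, if_false]; exact g3 _ (by omega)
  · intro j hj
    rw [sum_range_add]
    rw [sum_congr rfl (g := fun i => F i j), h4 j hj, sum_congr rfl (g := fun i => G i j), g4 j hj]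
    · simp
    · intro i _; simp
    · intro i hi; simp [mem_range.1 hi]

lemma ZR.hstack {m n n' : ℕ} {W W' : Set ℕ} (h : ZR m n W) (h' : ZR m n' W')
    (hd : Disjoint W W') : ZR m (n + n') (W ∪ W') :=
  (h.transp.vstack h'.transp hd).transp

/-- column pair from a zero sum tuple -/
lemma ZR.pair {m : ℕ} (f : ℕ → ℤ) (W : Set ℕ) (hW : ∀ i < m, (f i).natAbs ∈ W)
    (hne : ∀ i < m, f i ≠ 0)
    (hinj : ∀ i < m, ∀ j < m, (f i).natAbs = (f j).natAbs → i = j)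
    (hs : ∑ i ∈ range m, f i = 0) : ZR m 2 W := by
  refine ⟨fun i j => if j = 0 then f i else - f i, ?_, ?_, ?_, ?_⟩
  · intro i hi j hj
    dsimp only
    split_ifs
    · exact hW i hi
    · rw [Int.natAbs_neg]; exact hW i hi
  · intro i hi j hj i' hi' j' hj' h
    have hii : i = i' := by
      apply hinj i hi i' hi'
      dsimp only at h
      split_ifs at h <;> omega
    subst hii
    refine ⟨rfl, ?_⟩
    have := hne i hi
    dsimp only at h
    split_ifs at h <;> omega
  · intro i hi; simp [sum_range_succ]
  · intro j hj
    dsimp only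
    split_ifs
    · exact hs
    · simp [hs]

lemma ZR.quads4 (b s : ℕ) (hs : 1 ≤ s) : ZR 4 (2 * b) (Set.Ico s (s + 4 * b)) := by
  induction b with
  | zero => exact (ZR.zero 4 _).transp
  | succ b ih =>
    have h : ZR 4 2 (Set.Ico (s + 4 * b) (s + 4 * b + 4)) := by
      refine ZR.pair (fun i => if i = 0 then ((s + 4 * b : ℕ) : ℤ) else
        if i = 1 then - ((s + 4 * b : ℕ) : ℤ) - 1 else
        if i = 2 then - ((s + 4 * b : ℕ) : ℤ) - 2 else ((s + 4 * b : ℕ) : ℤ) + 3) _ ?_ ?_ ?_ ?_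
      · intro i hi; rw [Set.mem_Ico]; split_ifs <;> omega
      · intro i hi; split_ifs <;> omega
      · intro i hi j hj; split_ifs <;> omega
      · simp [sum_range_succ]; ring
    have := ih.hstack h (by
      rw [Set.disjoint_left]; intro x hx hx'; rw [Set.mem_Ico] at hx hx'; omega)
    refine this.mono ?_
    intro x hx
    simp only [Set.mem_union, Set.mem_Ico] at hx ⊢
    omega

lemma ZR.quads (a b s : ℕ) (hs : 1 ≤ s) : ZR (4 * a) (2 * b) (Set.Ico s (s + 4 * a * b)) := by
  induction a with
  | zero => exact ZR.zero _ _
  | succ a ih =>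
    have h := ZR.quads4 b (s + 4 * a * b) (by omega)
    have := ih.vstack h (by
      rw [Set.disjoint_left]; intro x hx hx'; rw [Set.mem_Ico] at hx hx'; omega)
    refine this.mono ?_
    intro x hx
    simp only [Set.mem_union, Set.mem_Ico] at hx ⊢
    have e : 4 * (a + 1) * b = 4 * a * b + 4 * b := by ring
    rw [e]
    omega

/-- stacking pairs of triples indexed by a finset -/
lemma ZR.triples (R : Finset ℕ) (A : ℕ → Set ℕ) (hA : ∀ c ∈ R, ZR 3 2 (A c))
    (hd : ∀ c ∈ R, ∀ d ∈ R, c ≠ d → Disjoint (A c) (A d)) :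
    ZR 3 (2 * R.card) (⋃ c ∈ R, A c) := by
  classical
  induction R using Finset.induction_on with
  | empty => exact (ZR.zero 3 _).transp
  | insert c R hc ih =>
    have h1 := ih (fun x hx => hA x (mem_insert_of_mem hx))
      (fun x hx y hy => hd x (mem_insert_of_mem hx) y (mem_insert_of_mem hy))
    have h2 := hA c (mem_insert_self _ _)
    rw [card_insert_of_notMem hc]
    refine (h1.hstack h2 ?_).mono ?_
    · rw [Set.disjoint_iUnion₂_left]
      intro x hx
      exact hd x (mem_insert_of_mem hx) c (mem_insert_self _ _) (by rintro rfl; exact hc hx)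
    · intro x hx
      simp only [Set.mem_union, Set.mem_iUnion, mem_insert] at hx ⊢
      rcases hx with ⟨d, hd, hx⟩ | hx
      · exact ⟨d, Or.inr hd, hx⟩
      · exact ⟨c, Or.inl rfl, hx⟩

def Supply (K T : ℕ) (W0 : Set ℕ) (R : Finset ℕ) (A : ℕ → Set ℕ) : Prop :=
  R.card = T ∧ ZR 3 5 W0 ∧ (∀ c ∈ R, ZR 3 2 (A c)) ∧ (∀ c ∈ R, Disjoint W0 (A c)) ∧
  (∀ c ∈ R, ∀ d ∈ R, c ≠ d → Disjoint (A c) (A d)) ∧ (∀ x ∈ W0, x ≤ K) ∧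
  (∀ c ∈ R, ∀ x ∈ A c, x ≤ K)

lemma tri_disj {R1 R2 R : Finset ℕ} {A : ℕ → Set ℕ}
    (hd : ∀ c ∈ R, ∀ d ∈ R, c ≠ d → Disjoint (A c) (A d)) (h1 : R1 ⊆ R) (h2 : R2 ⊆ R)
    (h : Disjoint R1 R2) : Disjoint (⋃ c ∈ R1, A c) (⋃ c ∈ R2, A c) := by
  rw [Set.disjoint_iUnion₂_left]
  intro x hx
  rw [Set.disjoint_iUnion₂_right]
  intro y hy
  exact hd x (h1 hx) y (h2 hy) (by rintro rfl; exact Finset.disjoint_left.1 h hx hy)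

lemma core_disj {R R1 : Finset ℕ} {A : ℕ → Set ℕ} {W0 : Set ℕ}
    (hd : ∀ c ∈ R, Disjoint W0 (A c)) (h1 : R1 ⊆ R) :
    Disjoint W0 (⋃ c ∈ R1, A c) := by
  rw [Set.disjoint_iUnion₂_right]
  intro x hx
  exact hd x (h1 hx)

/-- family one : `m = 3 + 4 q`, `n = 5 + 2 p`. -/
lemma fam1 (p q : ℕ) (K : ℕ) (hK : K = 7 + 3 * p + 6 * q) (W0 : Set ℕ) (R : Finset ℕ) (A : ℕ → Set ℕ)
    (h : Supply K (p + 2 * q) W0 R A) :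
    ZR (3 + 4 * q) (5 + 2 * p) (Set.Iic (K + 4 * q * (p + 1))) := by
  obtain ⟨hR, hc, hA, hd0, hd, hb0, hb⟩ := h
  obtain ⟨R1, hR1, hp⟩ := exists_subset_card_eq (show p ≤ R.card by omega)
  set R2 := R \ R1 with hR2
  have hR2s : R2 ⊆ R := sdiff_subset
  have hq : R2.card = 2 * q := by
    rw [hR2, card_sdiff_of_subset hR1]; omega
  have t1 := ZR.triples R1 A (fun c hc => hA c (hR1 hc))
    (fun c hc d hd' => hd c (hR1 hc) d (hR1 hd'))
  have t2 := ZR.triples R2 A (fun c hc => hA c (hR2s hc))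
    (fun c hc d hd' => hd c (hR2s hc) d (hR2s hd'))
  rw [hp] at t1
  rw [hq, show 2 * (2 * q) = 4 * q by ring] at t2
  have hu : ∀ R' ⊆ R, ∀ x ∈ (⋃ c ∈ R', A c), x ≤ K := by
    intro R' hR' x hx
    simp only [Set.mem_iUnion] at hx
    obtain ⟨c, hc, hx⟩ := hx
    exact hb c (hR' hc) x hx
  have top := hc.hstack t1 (core_disj hd0 hR1)
  have qd := ZR.quads q (p + 1) (K + 1) (by omega)
  have bot := t2.transp.hstack qd (by
    rw [Set.disjoint_left]; intro x hx hx'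
    have := hu R2 hR2s x hx
    rw [Set.mem_Ico] at hx'; omega)
  rw [show 3 + 2 * (p + 1) = 5 + 2 * p by ring] at bot
  refine (top.vstack bot ?_).mono ?_
  · rw [Set.disjoint_union_left, Set.disjoint_union_right, Set.disjoint_union_right]
    refine ⟨⟨core_disj hd0 hR2s, ?_⟩, tri_disj hd hR1 hR2s (disjoint_sdiff), ?_⟩
    · rw [Set.disjoint_left]; intro x hx hx'
      have := hb0 x hx
      rw [Set.mem_Ico] at hx'; omega
    · rw [Set.disjoint_left]; intro x hx hx'
      have := hu R1 hR1 x hx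
      rw [Set.mem_Ico] at hx'; omega
  · intro x hx
    rw [Set.mem_Iic]
    rcases hx with (hx | hx) | (hx | hx)
    · have := hb0 x hx; omega
    · have := hu R1 hR1 x hx; omega
    · have := hu R2 hR2s x hx; omega
    · rw [Set.mem_Ico] at hx; omega

lemma mem_tri {R R' : Finset ℕ} {A : ℕ → Set ℕ} {K : ℕ} (hb : ∀ c ∈ R, ∀ x ∈ A c, x ≤ K)
    (hR' : R' ⊆ R) : ∀ x ∈ (⋃ c ∈ R', A c), x ≤ K := by
  intro x hx
  simp only [Set.mem_iUnion] at hx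
  obtain ⟨c, hc, hx⟩ := hx
  exact hb c (hR' hc) x hx

lemma disj_Ico {W : Set ℕ} {a b : ℕ} (h : ∀ x ∈ W, x < a) : Disjoint W (Set.Ico a b) := by
  rw [Set.disjoint_left]; intro x hx hx'
  have := h x hx
  rw [Set.mem_Ico] at hx'; omega

/-- family two : `m = 5 + 4 q`, `n = 9 + 4 p`. -/
lemma fam2 (p q : ℕ) (K : ℕ) (W0 W5 : Set ℕ) (R : Finset ℕ)
    (A : ℕ → Set ℕ) (h : Supply K (2 + 2 * p + 2 * q) W0 R A) (h5 : ZR 5 2 W5)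
    (h50 : Disjoint W0 W5) (h5A : ∀ c ∈ R, Disjoint W5 (A c)) (h5b : ∀ x ∈ W5, x ≤ K) :
    ZR (5 + 4 * q) (9 + 4 * p) (Set.Iic (K + 4 * (p + 1) + 4 * q * (3 + 2 * p))) := by
  obtain ⟨hR, hc, hA, hd0, hd, hb0, hb⟩ := h
  obtain ⟨R1, hR1, hp⟩ := exists_subset_card_eq (show 1 + 2 * p ≤ R.card by omega)
  have hR1' : (R \ R1).card = 1 + 2 * q := by
    rw [card_sdiff_of_subset hR1]; omega
  obtain ⟨R2, hR2', hp2⟩ := exists_subset_card_eq (show 1 ≤ (R \ R1).card by omega)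
  set R3 := (R \ R1) \ R2 with hR3
  have hR2 : R2 ⊆ R := hR2'.trans sdiff_subset
  have hR3' : R3 ⊆ R \ R1 := sdiff_subset
  have hR3s : R3 ⊆ R := hR3'.trans sdiff_subset
  have hp3 : R3.card = 2 * q := by
    rw [hR3, card_sdiff_of_subset hR2']; omega
  have d12 : Disjoint R1 R2 := disjoint_sdiff.mono_right hR2'
  have d13 : Disjoint R1 R3 := disjoint_sdiff.mono_right hR3'
  have d23 : Disjoint R2 R3 := disjoint_sdiff
  have tt : ∀ R' ⊆ R, ZR 3 (2 * R'.card) (⋃ c ∈ R', A c) := fun R' hR' =>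
    ZR.triples R' A (fun c hc => hA c (hR' hc)) (fun c hc d hd' => hd c (hR' hc) d (hR' hd'))
  have t1 := tt R1 hR1
  have t2 := tt R2 hR2
  have t3 := tt R3 hR3s
  rw [hp] at t1
  rw [hp2] at t2
  rw [hp3, show 2 * (2 * q) = 4 * q by ring] at t3
  have b1 := mem_tri hb hR1
  have b2 := mem_tri hb hR2
  have b3 := mem_tri hb hR3s
  have D12 := tri_disj hd hR1 hR2 d12
  have D13 := tri_disj hd hR1 hR3s d13
  have D23 := tri_disj hd hR2 hR3s d23
  have D01 := core_disj hd0 hR1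
  have D02 := core_disj hd0 hR2
  have D03 := core_disj hd0 hR3s
  have D51 := core_disj h5A hR1
  have D52 := core_disj h5A hR2
  have D53 := core_disj h5A hR3s
  generalize (⋃ c ∈ R1, A c) = U1 at *
  generalize (⋃ c ∈ R2, A c) = U2 at *
  generalize (⋃ c ∈ R3, A c) = U3 at *
  have q1 := (ZR.quads (p + 1) 1 (K + 1) (by omega)).transp
  have q2 := ZR.quads q (3 + 2 * p) (K + 1 + 4 * (p + 1)) (by omega)
  rw [mul_one, mul_one] at q1
  have e1 : ∀ {a : ℕ} {W : Set ℕ}, (∀ x ∈ W, x ≤ K) → K < a → ∀ x ∈ W, x < a :=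
    fun h1 h2 x hx => lt_of_le_of_lt (h1 x hx) h2
  have x1 := hc.hstack t1 D01
  rw [show 5 + 2 * (1 + 2 * p) = 7 + 4 * p by ring] at x1
  have x2 := t2.transp.hstack q1 (disj_Ico (e1 b2 (by omega)))
  rw [show 3 + 4 * (p + 1) = 7 + 4 * p by ring] at x2
  have DQ : ∀ W : Set ℕ, (∀ x ∈ W, x ≤ K) → Disjoint W (Set.Ico (K + 1) (K + 1 + 4 * (p + 1))) :=
    fun W hW => disj_Ico (e1 hW (by omega))
  have DQ' : ∀ W : Set ℕ, (∀ x ∈ W, x ≤ K) → Disjoint W (Set.Ico (K + 1 + 4 * (p + 1))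
    (K + 1 + 4 * (p + 1) + 4 * q * (3 + 2 * p))) :=
    fun W hW => disj_Ico (e1 hW (by omega))
  have x3 := x1.vstack x2 (by
    simp only [Set.disjoint_union_left, Set.disjoint_union_right]
    exact ⟨⟨D02, D12⟩, DQ _ hb0, DQ _ b1⟩)
  have x4 := x3.hstack h5 (by
    simp only [Set.disjoint_union_left]
    exact ⟨⟨h50, D51.symm⟩, D52.symm, (DQ _ h5b).symm⟩)
  rw [show 7 + 4 * p + 2 = 9 + 4 * p by ring, show 3 + 2 * 1 = 5 by rfl] at x4
  have x5 := t3.transp.hstack q2 (DQ' _ b3)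
  rw [show 3 + 2 * (3 + 2 * p) = 9 + 4 * p by ring] at x5
  refine (x4.vstack x5 ?_).mono ?_
  · simp only [Set.disjoint_union_left, Set.disjoint_union_right]
    refine ⟨⟨⟨⟨D03, D13⟩, D23, (DQ _ b3).symm⟩, D53⟩, ⟨⟨DQ' _ hb0, DQ' _ b1⟩, DQ' _ b2, ?_⟩, DQ' _ h5b⟩
    apply disj_Ico
    intro x hx
    exact hx.2
  · intro x hx
    rw [Set.mem_Iic]
    rcases hx with (((hx | hx) | (hx | hx)) | hx) | (hx | hx)
    · have := hb0 x hx; omega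
    · have := b1 x hx; omega
    · have := b2 x hx; omega
    · rw [Set.mem_Ico] at hx; omega
    · have := h5b x hx; omega
    · have := b3 x hx; omega
    · rw [Set.mem_Ico] at hx; omega

lemma ZR_code (m n N : ℕ) (v : ℕ → ℤ) (W : Set ℕ) (a : ℕ → ℕ → ℕ) (s : ℕ → ℕ → ℤ)
    (hv : ∀ x < N, ∀ y < N, (v x).natAbs = (v y).natAbs → x = y) (hv0 : v 0 = 0)
    (hW : ∀ x < N, (v x).natAbs ∈ W) (hN : 0 < N)
    (ha : ∀ i < m, ∀ j < n, a i j < N) (hs : ∀ i < m, ∀ j < n, s i j = 1 ∨ s i j = -1)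
    (hinj : ∀ i < m, ∀ j < n, ∀ i' < m, ∀ j' < n, ¬ (a i j = a i' j' ∧
      (s i j = s i' j' ∨ a i j = 0) ∧ ¬ (i = i' ∧ j = j')))
    (hr : ∀ i < m, ∑ j ∈ range n, s i j * v (a i j) = 0)
    (hc : ∀ j < n, ∑ i ∈ range m, s i j * v (a i j) = 0) : ZR m n W := by
  have key : ∀ i < m, ∀ j < n, (s i j * v (a i j)).natAbs = (v (a i j)).natAbs := by
    intro i hi j hj
    rcases hs i hi j hj with h | h <;> simp [h]
  refine ⟨fun i j => s i j * v (a i j), ?_, ?_, hr, hc⟩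
  · intro i hi j hj
    rw [key i hi j hj]; exact hW _ (ha i hi j hj)
  · intro i hi j hj i' hi' j' hj' h
    have e := congrArg Int.natAbs h
    rw [key i hi j hj, key i' hi' j' hj'] at e
    have e' := hv _ (ha i hi j hj) _ (ha i' hi' j' hj') e
    by_contra hcon
    refine hinj i hi j hj i' hi' j' hj' ⟨e', ?_, hcon⟩
    by_cases h0 : a i j = 0
    · exact Or.inr h0
    · left
      have hne : v (a i j) ≠ 0 := by
        intro hz
        exact h0 (hv _ (ha i hi j hj) 0 hN (by rw [hz, hv0]))
      dsimp only at h
      rw [← e'] at h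
      exact mul_right_cancel₀ hne h

def tab {α : Type} (d : α) (l : List (List α)) (i j : ℕ) : α := (l.getD i []).getD j d

set_option maxRecDepth 10000 in
set_option synthInstance.maxHeartbeats 200000 in
set_option synthInstance.maxSize 2000 in
lemma core2 (v : ℕ → ℤ) (W : Set ℕ)
    (hv : ∀ x < 8, ∀ y < 8, (v x).natAbs = (v y).natAbs → x = y) (hv0 : v 0 = 0)
    (hW : ∀ x < 8, (v x).natAbs ∈ W) (hy : v 2 + v 3 + v 4 = 0) (hz : v 5 + v 6 + v 7 = 0)
    (hx : v 1 = (v 3 - v 2) + (v 6 - v 5)) : ZR 3 5 W := by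
  refine ZR_code 3 5 8 v W (tab 0 [[1,3,2,6,5],[0,4,4,7,7],[1,2,3,5,6]])
    (tab 0 [[-1,1,-1,1,-1],[1,1,-1,1,-1],[1,1,-1,1,-1]]) hv hv0 hW (by norm_num)
    (by decide) (by decide) (by decide) ?_ ?_
  · intro i hi
    interval_cases i <;> simp [sum_range_succ, tab] <;> linarith
  · intro i hi
    interval_cases i <;> simp [sum_range_succ, tab] <;> linarith

set_option maxRecDepth 10000 in
set_option synthInstance.maxHeartbeats 200000 in
set_option synthInstance.maxSize 2000 in
lemma core1 (v : ℕ → ℤ) (W : Set ℕ)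
    (hv : ∀ x < 8, ∀ y < 8, (v x).natAbs = (v y).natAbs → x = y) (hv0 : v 0 = 0)
    (hW : ∀ x < 8, (v x).natAbs ∈ W) (hy : v 2 + v 3 + v 4 = 0) (hz : v 5 + v 6 + v 7 = 0)
    (hx : v 1 = (v 3 - v 2)) : ZR 3 5 W := by
  refine ZR_code 3 5 8 v W (tab 0 [[1,3,2,5,5],[0,4,4,6,6],[1,2,3,7,7]])
    (tab 0 [[-1,1,-1,1,-1],[1,1,-1,1,-1],[1,1,-1,1,-1]]) hv hv0 hW (by norm_num)
    (by decide) (by decide) (by decide) ?_ ?_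
  · intro i hi
    interval_cases i <;> simp [sum_range_succ, tab] <;> linarith
  · intro i hi
    interval_cases i <;> simp [sum_range_succ, tab] <;> linarith

structure IsQ (k : ℤ) (q : ℤ → ℤ) : Prop where
  lo : ∀ c, -k ≤ c → c ≤ k → -k ≤ q c
  hi : ∀ c, -k ≤ c → c ≤ k → q c ≤ k
  inj : ∀ c d, -k ≤ c → c ≤ k → -k ≤ d → d ≤ k → q c = q d → c = d
  neg : ∀ c, -k ≤ c → c ≤ k → q (-c) = q c + c

def AZ (L : ℤ) (q : ℤ → ℤ) (c : ℤ) : Set ℕ :=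
  {x | x = c.natAbs ∨ (x : ℤ) = L - q c ∨ (x : ℤ) = L - q (-c)}

lemma AZ_neg (L : ℤ) (q : ℤ → ℤ) (c : ℤ) : AZ L q (-c) = AZ L q c := by
  ext x
  simp only [AZ, Set.mem_ofPred_eq, Int.natAbs_neg, neg_neg]
  tauto

lemma AZ_abs (L : ℤ) (q : ℤ → ℤ) (c : ℤ) : AZ L q (c.natAbs : ℤ) = AZ L q c := by
  rcases Int.natAbs_eq c with h | h
  · rw [← h]
  · conv_rhs => rw [h, AZ_neg]

lemma AZ_disj {k L : ℤ} {q : ℤ → ℤ} (hq : IsQ k q) (hL : 2 * k + 1 ≤ L) {c d : ℤ}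
    (hc : -k ≤ c) (hc' : c ≤ k) (hd : -k ≤ d) (hd' : d ≤ k) (h : c.natAbs ≠ d.natAbs) :
    Disjoint (AZ L q c) (AZ L q d) := by
  rw [Set.disjoint_left]
  intro x hx hx'
  have a1 := hq.hi c hc hc'
  have a2 := hq.hi (-c) (by omega) (by omega)
  have a3 := hq.hi d hd hd'
  have a4 := hq.hi (-d) (by omega) (by omega)
  have b1 := hq.inj c d hc hc' hd hd'
  have b2 := hq.inj c (-d) hc hc' (by omega) (by omega)
  have b3 := hq.inj (-c) d (by omega) (by omega) hd hd'
  have b4 := hq.inj (-c) (-d) (by omega) (by omega) (by omega) (by omega)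
  rcases hx with hx | hx | hx <;> rcases hx' with hx' | hx' | hx'
  · omega
  · omega
  · omega
  · omega
  · have := b1 (by omega); omega
  · have := b2 (by omega); omega
  · omega
  · have := b3 (by omega); omega
  · have := b4 (by omega); omega

lemma AZ_le {k L : ℤ} {q : ℤ → ℤ} (hq : IsQ k q) (hL : 2 * k + 1 ≤ L) {c : ℤ}
    (hc : -k ≤ c) (hc' : c ≤ k) : ∀ x ∈ AZ L q c, (x : ℤ) ≤ L + k := by
  intro x hx
  have a1 := hq.lo c hc hc'
  have a2 := hq.lo (-c) (by omega) (by omega)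
  rcases hx with hx | hx | hx <;> omega

lemma AZ_pair {k L : ℤ} {q : ℤ → ℤ} (hq : IsQ k q) (hL : 2 * k + 1 ≤ L) {c : ℤ}
    (hc : -k ≤ c) (hc' : c ≤ k) (h0 : c ≠ 0) : ZR 3 2 (AZ L q c) := by
  have a1 := hq.hi c hc hc'
  have a2 := hq.hi (-c) (by omega) (by omega)
  have a3 := hq.neg c hc hc'
  refine ZR.pair (fun i => if i = 0 then q c - L else if i = 1 then c else L - q (-c)) _ ?_ ?_ ?_ ?_
  · intro i hi
    simp only [AZ, Set.mem_ofPred_eq]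
    split_ifs <;> omega
  · intro i hi; split_ifs <;> omega
  · intro i hi j hj; split_ifs <;> omega
  · simp [sum_range_succ]; omega

lemma core_inj {k L : ℤ} {q : ℤ → ℤ} (hq : IsQ k q) (hL : 2 * k + 1 ≤ L) {c d : ℤ}
    (hc : -k ≤ c) (hc' : c ≤ k) (hd : -k ≤ d) (hd' : d ≤ k) (h : c.natAbs ≠ d.natAbs)
    (hc0 : c ≠ 0) (hd0 : d ≠ 0) :
    ∃ v : ℕ → ℤ, (∀ x < 8, ∀ y < 8, (v x).natAbs = (v y).natAbs → x = y) ∧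
      (∀ x < 8, (v x).natAbs ∈ AZ L q 0 ∪ AZ L q c ∪ AZ L q d) ∧
      v 0 = 0 ∧ v 1 = L - q 0 ∧ v 2 = q c - L ∧ v 3 = c ∧ v 4 = L - q (-c) ∧
      v 5 = q d - L ∧ v 6 = d ∧ v 7 = L - q (-d) := by
  have a1 := hq.hi c hc hc'
  have a2 := hq.hi (-c) (by omega) (by omega)
  have a3 := hq.hi d hd hd'
  have a4 := hq.hi (-d) (by omega) (by omega)
  have a0 := hq.hi 0 (by omega) (by omega)
  have b1 : q c ≠ q d := fun e => by
    have := hq.inj c d hc hc' hd hd' e; omega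
  have b2 : q c ≠ q (-d) := fun e => by
    have := hq.inj c (-d) hc hc' (by omega) (by omega) e; omega
  have b3 : q (-c) ≠ q d := fun e => by
    have := hq.inj (-c) d (by omega) (by omega) hd hd' e; omega
  have b4 : q (-c) ≠ q (-d) := fun e => by
    have := hq.inj (-c) (-d) (by omega) (by omega) (by omega) (by omega) e; omega
  have b5 : q c ≠ q (-c) := fun e => by
    have := hq.inj c (-c) hc hc' (by omega) (by omega) e; omega
  have b6 : q d ≠ q (-d) := fun e => by
    have := hq.inj d (-d) hd hd' (by omega) (by omega) e; omega
  have b7 : q 0 ≠ q c := fun e => by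
    have := hq.inj 0 c (by omega) (by omega) hc hc' e; omega
  have b8 : q 0 ≠ q (-c) := fun e => by
    have := hq.inj 0 (-c) (by omega) (by omega) (by omega) (by omega) e; omega
  have b9 : q 0 ≠ q d := fun e => by
    have := hq.inj 0 d (by omega) (by omega) hd hd' e; omega
  have b10 : q 0 ≠ q (-d) := fun e => by
    have := hq.inj 0 (-d) (by omega) (by omega) (by omega) (by omega) e; omega
  refine ⟨fun x => [0, L - q 0, q c - L, c, L - q (-c), q d - L, d, L - q (-d)].getD x 0,
    ?_, ?_, rfl, rfl, rfl, rfl, rfl, rfl, rfl, rfl⟩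
  · have e0 : ∀ t : ℤ, t ≤ k → (L - t).natAbs = (L - t).toNat := by intro t ht; omega
    have e1 : ∀ t : ℤ, t ≤ k → (t - L).natAbs = (L - t).toNat := by intro t ht; omega
    intro x hx y hy e
    by_contra hne
    interval_cases x <;> interval_cases y <;> first
      | exact hne rfl
      | (clear hne; simp only [List.getD_cons_succ, List.getD_cons_zero] at e; omega)
  · intro x hx
    simp only [AZ, Set.mem_union, Set.mem_ofPred_eq]
    interval_cases x
    · left; left; left; rfl
    · left; left; right; left; simp only [List.getD_cons_succ, List.getD_cons_zero]; omega
    · left; right; right; left; simp only [List.getD_cons_succ, List.getD_cons_zero]; omega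
    · left; right; left; rfl
    · left; right; right; right; simp only [List.getD_cons_succ, List.getD_cons_zero]; omega
    · right; right; left; simp only [List.getD_cons_succ, List.getD_cons_zero]; omega
    · right; left; rfl
    · right; right; right; simp only [List.getD_cons_succ, List.getD_cons_zero]; omega

lemma supply_of {k : ℕ} {L : ℤ} {q : ℤ → ℤ} (hq : IsQ k q) (hL : 2 * (k : ℤ) + 1 ≤ L) {c d : ℤ}
    (hc : -(k : ℤ) ≤ c) (hc' : c ≤ k) (hd : -(k : ℤ) ≤ d) (hd' : d ≤ k) (h : c.natAbs ≠ d.natAbs)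
    (hc0 : c ≠ 0) (hd0 : d ≠ 0)
    (hx : L - q 0 = (L - q c + c) + (L - q d + d) ∨ L - q 0 = L - q c + c)
    (R : Finset ℕ) (hR : ∀ x ∈ R, 1 ≤ x ∧ x ≤ k ∧ x ≠ c.natAbs ∧ x ≠ d.natAbs) (K : ℕ)
    (hK : L + k ≤ K) :
    Supply K R.card (AZ L q 0 ∪ AZ L q c ∪ AZ L q d) R (fun x => AZ L q (x : ℤ)) := by
  refine ⟨rfl, ?_, ?_, ?_, ?_, ?_, ?_⟩
  · obtain ⟨v, h1, h2, v0, v1, v2, v3, v4, v5, v6, v7⟩ := core_inj hq hL hc hc' hd hd' h hc0 hd0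
    have n1 := hq.neg c hc hc'
    have n2 := hq.neg d hd hd'
    rcases hx with hx | hx
    · exact core2 v _ h1 v0 h2 (by rw [v2, v3, v4]; omega) (by rw [v5, v6, v7]; omega)
        (by rw [v1, v2, v3, v5, v6]; omega)
    · exact core1 v _ h1 v0 h2 (by rw [v2, v3, v4]; omega) (by rw [v5, v6, v7]; omega)
        (by rw [v1, v2, v3]; omega)
  · intro x hx
    have := hR x hx
    exact AZ_pair hq hL (by omega) (by omega) (by omega)
  · intro x hx
    have := hR x hx
    simp only [Set.disjoint_union_left]
    refine ⟨⟨?_, ?_⟩, ?_⟩ <;> apply AZ_disj hq hL <;> omega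
  · intro x hx y hy hxy
    have := hR x hx
    have := hR y hy
    apply AZ_disj hq hL <;> omega
  · rintro x ((hx | hx) | hx)
    · have := AZ_le hq hL (by omega) (by omega) x hx; omega
    · have := AZ_le hq hL (by omega) (by omega) x hx; omega
    · have := AZ_le hq hL (by omega) (by omega) x hx; omega
  · intro y hy x hx
    have := hR y hy
    have := AZ_le hq hL (by omega) (by omega) x hx; omega

def qp (k c : ℤ) : ℤ :=
  if c % 2 = 0 then -((k + 1) / 2) - c / 2 else (2 * k + 1 - c) / 2 - (k + 1) / 2

def qm (k c : ℤ) : ℤ :=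
  if c % 2 = 0 then (k + 1) / 2 - c / 2 else (k + 1) / 2 + (- (2 * k + 1) - c) / 2

lemma qp_isQ (k : ℤ) : IsQ k (qp k) := by
  constructor
  · intro c h1 h2; unfold qp; split_ifs <;> omega
  · intro c h1 h2; unfold qp; split_ifs <;> omega
  · intro c d h1 h2 h3 h4; unfold qp; split_ifs <;> omega
  · intro c h1 h2; unfold qp; split_ifs <;> omega

lemma qm_isQ (k : ℤ) : IsQ k (qm k) := by
  constructor
  · intro c h1 h2; unfold qm; split_ifs <;> omega
  · intro c h1 h2; unfold qm; split_ifs <;> omega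
  · intro c d h1 h2 h3 h4; unfold qm; split_ifs <;> omega
  · intro c h1 h2; unfold qm; split_ifs <;> omega

lemma ZR_list (m n : ℕ) (l : List (List ℤ)) (w : List ℕ)
    (h1 : ∀ i < m, ∀ j < n, (tab 0 l i j).natAbs ∈ w)
    (h2 : ∀ i < m, ∀ j < n, ∀ i' < m, ∀ j' < n,
      ¬ (tab 0 l i j = tab 0 l i' j' ∧ ¬ (i = i' ∧ j = j')))
    (h3 : ∀ i < m, ∑ j ∈ range n, tab 0 l i j = 0)
    (h4 : ∀ j < n, ∑ i ∈ range m, tab 0 l i j = 0) : ZR m n {x | x ∈ w} := by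
  refine ⟨tab 0 l, h1, ?_, h3, h4⟩
  intro i hi j hj i' hi' j' hj' e
  by_contra hc
  exact h2 i hi j hj i' hi' j' hj' ⟨e, hc⟩

lemma supply_list (K T : ℕ) (w : List ℕ) (g : ℕ → List ℕ) (hz : ZR 3 5 {x | x ∈ w})
    (hg : ∀ c < T, (g c).getD 0 0 + (g c).getD 1 0 = (g c).getD 2 0 ∧ 0 < (g c).getD 0 0 ∧
      (g c).getD 0 0 < (g c).getD 1 0)
    (hg' : ∀ c < T, (g c).length = 3)
    (hd : ∀ c < T, ∀ x ∈ g c, x ∉ w) (hd' : ∀ c < T, ∀ d < T, c ≠ d → ∀ x ∈ g c, x ∉ g d)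
    (hK : ∀ x ∈ w, x ≤ K) (hK' : ∀ c < T, ∀ x ∈ g c, x ≤ K) :
    Supply K T {x | x ∈ w} (range T) (fun c => {x | x ∈ g c}) := by
  refine ⟨card_range T, hz, ?_, ?_, ?_, hK, ?_⟩
  · intro c hc
    rw [mem_range] at hc
    have a := hg c hc
    have b := hg' c hc
    obtain ⟨x, y, z, hxyz⟩ := List.length_eq_three.1 b
    rw [hxyz] at a
    simp at a
    refine ZR.pair (fun i => if i = 0 then (x : ℤ) else if i = 1 then (y : ℤ) else - (z : ℤ)) _ ?_ ?_ ?_ ?_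
    · intro i hi
      simp only [Set.mem_ofPred_eq, hxyz, List.mem_cons, List.not_mem_nil]
      split_ifs <;> omega
    · intro i hi; split_ifs <;> omega
    · intro i hi j hj; split_ifs <;> omega
    · simp [sum_range_succ]; omega
  · intro c hc
    rw [mem_range] at hc
    rw [Set.disjoint_left]
    intro x hx hx'
    exact hd c hc x hx' hx
  · intro c hc d hd'' hne
    rw [mem_range] at hc hd''
    rw [Set.disjoint_left]
    intro x hx hx'
    exact hd' c hc d hd'' hne x hx hx'
  · intro c hc x hx
    exact hK' c (mem_range.1 hc) x hx

set_option maxRecDepth 10000 in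
set_option synthInstance.maxHeartbeats 200000 in
set_option synthInstance.maxSize 2000 in
lemma supply_0 : ∃ W0 R A, Supply 7 0 W0 R A :=
  ⟨_, _, _, supply_list 7 0 [0,1,2,3,4,5,6,7] (fun _ => [])
    (ZR_list 3 5 [[-7,-6,3,6,4],[0,1,2,-2,-1],[7,5,-5,-4,-3]] _
      (by decide) (by decide) (by decide) (by decide))
    (by decide) (by decide) (by decide) (by decide) (by decide) (by decide)⟩

set_option maxRecDepth 10000 in
set_option synthInstance.maxHeartbeats 200000 in
set_option synthInstance.maxSize 2000 in
lemma supply_1 : ∃ W0 R A, Supply 10 1 W0 R A :=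
  ⟨_, _, _, supply_list 10 1 [0,2,3,4,5,6,7,8] (fun _ => [1,9,10])
    (ZR_list 3 5 [[-8,-7,8,0,7],[2,3,-6,5,-4],[6,4,-2,-5,-3]] _
      (by decide) (by decide) (by decide) (by decide))
    (by decide) (by decide) (by decide) (by decide) (by decide) (by decide)⟩

set_option maxRecDepth 10000 in
set_option synthInstance.maxHeartbeats 200000 in
set_option synthInstance.maxSize 2000 in
lemma supply_7 : ∃ W0 R A, Supply 28 7 W0 R A :=
  ⟨_, _, _, supply_list 28 7 [0,4,5,11,13,15,16,18]
    (fun i => [[1,27,28],[2,24,26],[3,22,25],[6,17,23],[7,14,21],[8,12,20],[9,10,19]].getD i [])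
    (ZR_list 3 5 [[-18,16,11,-5,-4],[5,-16,4,18,-11],[13,0,-15,-13,15]] _
      (by decide) (by decide) (by decide) (by decide))
    (by decide) (by decide) (by decide) (by decide) (by decide) (by decide)⟩

lemma supply_of' {T : ℕ} {q : ℤ → ℤ} {k : ℤ} (hk : k = T + 2) (hq : IsQ k q) (c d : ℤ)
    (hc : -k ≤ c) (hc' : c ≤ k) (hd : -k ≤ d) (hd' : d ≤ k)
    (h : c.natAbs ≠ d.natAbs)
    (hc0 : c ≠ 0) (hd0 : d ≠ 0)
    (hx : (2 * k + 1) - q 0 = ((2 * k + 1) - q c + c) + ((2 * k + 1) - q d + d) ∨ 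
      (2 * k + 1) - q 0 = (2 * k + 1) - q c + c) :
    ∃ W0 R A, Supply (7 + 3 * T) T W0 R A := by
  obtain rfl : k = ((T + 2 : ℕ) : ℤ) := by rw [hk]; push_cast; rfl
  have := supply_of hq le_rfl hc hc' hd hd' h hc0 hd0 hx
    (((Icc 1 (T + 2)).erase c.natAbs).erase d.natAbs) (by
      intro x hx
      simp only [mem_erase, mem_Icc] at hx
      omega) (7 + 3 * T) (by push_cast; omega)
  rw [card_erase_of_mem (by simp only [mem_erase, mem_Icc]; omega),
    card_erase_of_mem (by simp only [mem_Icc]; omega), Nat.card_Icc] at this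
  exact ⟨_, _, _, this⟩

lemma supply_exists (T : ℕ) : ∃ W0 R A, Supply (7 + 3 * T) T W0 R A := by
  obtain ⟨k, hk⟩ : ∃ k : ℤ, k = T + 2 := ⟨_, rfl⟩
  by_cases h0 : T = 0
  · subst h0; exact supply_0
  by_cases h1 : T = 1
  · subst h1; exact supply_1
  by_cases h7 : T = 7
  · subst h7; exact supply_7
  by_cases c1 : (2 * k + 1) % 3 = 0
  · refine supply_of' hk (qp_isQ k) ((2 * k + 1) / 3) 2 ?_ ?_ ?_ ?_ ?_ ?_ ?_ (Or.inr ?_) <;>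
      try unfold qp
    all_goals first | omega | (split_ifs <;> omega)
  by_cases c2 : ((k + 1) / 2) % 3 = 0
  · refine supply_of' hk (qp_isQ k) 1 (- (2 * ((k + 1) / 2) / 3) - 1) ?_ ?_ ?_ ?_ ?_ ?_ ?_ (Or.inl ?_) <;>
      try unfold qp
    all_goals first | omega | (split_ifs <;> omega)
  by_cases c3 : k % 2 = 0
  · refine supply_of' hk (qp_isQ k) (- k) (- ((2 * k + 2) / 3)) ?_ ?_ ?_ ?_ ?_ ?_ ?_ (Or.inl ?_) <;>
      try unfold qp
    all_goals first | omega | (split_ifs <;> omega)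
  · refine supply_of' hk (qp_isQ k) (- (k - 1)) (- ((2 * k + 6) / 3)) ?_ ?_ ?_ ?_ ?_ ?_ ?_ (Or.inl ?_) <;>
      try unfold qp
    all_goals first | omega | (split_ifs <;> omega)

lemma ZR_fam1 (m n : ℕ) (hm : m % 4 = 3) (hn : n % 2 = 1) (hn5 : 5 ≤ n) :
    ZR m n (Set.Iic ((m * n - 1) / 2)) := by
  obtain ⟨q, rfl⟩ : ∃ q, m = 3 + 4 * q := ⟨m / 4, by omega⟩
  obtain ⟨p, rfl⟩ : ∃ p, n = 5 + 2 * p := ⟨(n - 5) / 2, by omega⟩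
  obtain ⟨W0, R, A, h⟩ := supply_exists (p + 2 * q)
  have := fam1 p q _ (by ring) W0 R A h
  refine this.mono (Set.Iic_subset_Iic.2 ?_)
  have e : (3 + 4 * q) * (5 + 2 * p) = 2 * (7 + 3 * (p + 2 * q) + 4 * q * (p + 1)) + 1 := by ring
  omega

lemma W5_notAZ {k L : ℤ} {q : ℤ → ℤ} (hq : IsQ k q) (hL : L = 2 * k + 2) (hk : 0 ≤ k) {c : ℤ}
    (hc : -k ≤ c) (hc' : c ≤ k) :
    Disjoint (AZ L q c) {x : ℕ | (x : ℤ) = k + 1 ∨ (x : ℤ) = 3 * k + 3} := by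
  rw [Set.disjoint_left]
  intro x hx hx'
  have a1 := hq.hi c hc hc'
  have a2 := hq.hi (-c) (by omega) (by omega)
  have a3 := hq.lo c hc hc'
  have a4 := hq.lo (-c) (by omega) (by omega)
  rcases hx with hx | hx | hx <;> rcases hx' with hx' | hx' <;> omega

lemma W5_ZR {k L : ℤ} {q : ℤ → ℤ} (hq : IsQ k q) (hL : L = 2 * k + 2) (hk : 0 < k) {c : ℤ}
    (hck : c = k ∨ c = -k) (h0 : q (-c) = 0) :
    ZR 5 2 (AZ L q c ∪ {x : ℕ | (x : ℤ) = k + 1 ∨ (x : ℤ) = 3 * k + 3}) := by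
  have a1 := hq.hi c (by omega) (by omega)
  have a3 := hq.lo c (by omega) (by omega)
  have a5 := hq.neg c (by omega) (by omega)
  refine ZR.pair (fun i => if i = 0 then q c - L else if i = 1 then c else if i = 2 then - L else
    if i = 3 then k + 1 else 3 * k + 3) _ ?_ ?_ ?_ ?_
  · intro i hi
    simp only [AZ, Set.mem_ofPred_eq, Set.mem_union]
    split_ifs <;> omega
  · intro i hi; split_ifs <;> omega
  · intro i hi j hj; split_ifs <;> omega
  · simp [sum_range_succ]; omega

lemma ZR_fam2_of (p q : ℕ) {k L : ℤ} {f : ℤ → ℤ} (hk : k = 5 + 2 * p + 2 * q) (hL : L = 2 * k + 2)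
    (hq : IsQ k f) (c5 c d : ℤ) (hck : c5 = k ∨ c5 = -k) (h0 : f (-c5) = 0)
    (hc : -k < c) (hc' : c < k) (hd : -k < d) (hd' : d < k)
    (h : c.natAbs ≠ d.natAbs) (hc0 : c ≠ 0) (hd0 : d ≠ 0)
    (hx : L - f 0 = (L - f c + c) + (L - f d + d) ∨ L - f 0 = L - f c + c) :
    ZR (5 + 4 * q) (9 + 4 * p) (Set.Iic (((5 + 4 * q) * (9 + 4 * p) - 1) / 2)) := by
  obtain rfl : k = ((5 + 2 * p + 2 * q : ℕ) : ℤ) := by rw [hk]; push_cast; rfl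
  have := supply_of hq (L := L) (by omega) hc.le hc'.le hd.le hd'.le h hc0 hd0 hx
    (((Icc 1 (4 + 2 * p + 2 * q)).erase c.natAbs).erase d.natAbs) (by
      intro x hx
      simp only [mem_erase, mem_Icc] at hx
      omega) (18 + 6 * p + 6 * q) (by push_cast at *; omega)
  rw [card_erase_of_mem (by simp only [mem_erase, mem_Icc]; omega),
    card_erase_of_mem (by simp only [mem_Icc]; omega), Nat.card_Icc,
    show 4 + 2 * p + 2 * q + 1 - 1 - 1 - 1 = 2 + 2 * p + 2 * q by omega] at this
  have f2 := fam2 p q _ _ _ _ _ this (W5_ZR hq hL (by omega) hck h0) ?_ ?_ ?_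
  · refine f2.mono (Set.Iic_subset_Iic.2 ?_)
    have e : (5 + 4 * q) * (9 + 4 * p) = 2 * (18 + 6 * p + 6 * q + 4 * (p + 1) + 4 * q * (3 + 2 * p)) + 1 := by
      ring
    omega
  · simp only [Set.disjoint_union_left, Set.disjoint_union_right]
    refine ⟨⟨⟨?_, ?_⟩, ?_⟩, ⟨?_, ?_⟩, ?_⟩
    · apply AZ_disj hq <;> omega
    · apply AZ_disj hq <;> omega
    · apply AZ_disj hq <;> omega
    all_goals apply W5_notAZ hq <;> omega
  · intro x hx
    simp only [mem_erase, mem_Icc] at hx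
    rw [Set.disjoint_union_left]
    refine ⟨?_, Disjoint.symm ?_⟩
    · apply AZ_disj hq <;> omega
    · apply W5_notAZ hq <;> omega
  · rintro x (hx | hx)
    · have := AZ_le hq (by omega) (by omega) (by omega) x hx
      omega
    · simp only [Set.mem_ofPred_eq] at hx
      omega

lemma ZR_fam2 (m n : ℕ) (hm : m % 4 = 1) (hn : n % 4 = 1) (hm5 : 5 ≤ m) (hn5 : 9 ≤ n) :
    ZR m n (Set.Iic ((m * n - 1) / 2)) := by
  obtain ⟨q, rfl⟩ : ∃ q, m = 5 + 4 * q := ⟨(m - 5) / 4, by omega⟩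
  obtain ⟨p, rfl⟩ : ∃ p, n = 9 + 4 * p := ⟨(n - 9) / 4, by omega⟩
  obtain ⟨k, hk⟩ : ∃ k : ℤ, k = 5 + 2 * p + 2 * q := ⟨_, rfl⟩
  by_cases c1 : ((k + 1) / 2) % 3 = 0
  · refine ZR_fam2_of p q hk rfl (qm_isQ k) k (-2) (- (k - 1)) ?_ ?_ ?_ ?_ ?_ ?_ ?_ ?_ ?_ (Or.inl ?_) <;>
      try unfold qm
    all_goals first | omega | (split_ifs <;> omega)
  by_cases c2 : ((k + 1) / 2) % 3 = 2
  · refine ZR_fam2_of p q hk rfl (qp_isQ k) (-k) 1 (- (2 * ((k + 1) / 2 + 1) / 3) - 1)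
      ?_ ?_ ?_ ?_ ?_ ?_ ?_ ?_ ?_ (Or.inl ?_) <;> try unfold qp
    all_goals first | omega | (split_ifs <;> omega)
  · refine ZR_fam2_of p q hk rfl (qp_isQ k) (-k) ((2 * k + 1) / 3) 2
      ?_ ?_ ?_ ?_ ?_ ?_ ?_ ?_ ?_ (Or.inr ?_) <;> try unfold qp
    all_goals first | omega | (split_ifs <;> omega)

lemma ZR_odd (m n : ℕ) (hm : m % 2 = 1) (hn : n % 2 = 1) (hm3 : 3 ≤ m) (hn3 : 3 ≤ n) (hmn : m ≠ n) :
    ZR m n (Set.Iic ((m * n - 1) / 2)) := by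
  by_cases h1 : m % 4 = 3
  · by_cases h2 : 5 ≤ n
    · exact ZR_fam1 m n h1 hn h2
    · rw [mul_comm]
      exact (ZR_fam1 n m (by omega) hm (by omega)).transp
  · by_cases h2 : n % 4 = 3
    · rw [mul_comm]
      exact (ZR_fam1 n m h2 hm (by omega)).transp
    · rcases lt_or_gt_of_ne hmn with h | h
      · exact ZR_fam2 m n (by omega) (by omega) (by omega) (by omega)
      · rw [mul_comm]
        exact (ZR_fam2 n m (by omega) (by omega) (by omega) (by omega)).transp

def MRS (m n r : ℕ) : Prop :=
  ∃ F : Fin r → Fin m → Fin n → ℕ,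
    (∀ t i j, F t i j ∈ Finset.Icc 1 (m * n * r)) ∧
    Function.Injective (fun p : Fin r × Fin m × Fin n => F p.1 p.2.1 p.2.2) ∧
    (∀ t i, 2 * ∑ j, F t i j = n * (m * n * r + 1)) ∧
    (∀ t j, 2 * ∑ i, F t i j = m * (m * n * r + 1))

lemma MRS.transp {m n r : ℕ} (h : MRS m n r) : MRS n m r := by
  obtain ⟨F, h1, h2, h3, h4⟩ := h
  refine ⟨fun t i j => F t j i, ?_, ?_, ?_, ?_⟩
  · intro t i j; rw [mul_comm n m]; exact h1 t j i
  · rintro ⟨t, i, j⟩ ⟨t', i', j'⟩ e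
    have := h2 (a₁ := (t, j, i)) (a₂ := (t', j', i')) e
    simp only [Prod.mk.injEq] at this ⊢
    tauto
  · intro t i; rw [mul_comm n m]; exact h4 t i
  · intro t i; rw [mul_comm n m]; exact h3 t i

lemma MRS_of (m n r : ℕ) (H : ℕ → ℕ → ℕ → ℤ)
    (hp : ∀ t < r, ∀ i < m, ∀ j < n, (H t i j + (m * n * r : ℕ) + 1) % 2 = 0)
    (hl : ∀ t < r, ∀ i < m, ∀ j < n, - ((m * n * r : ℕ) : ℤ) + 1 ≤ H t i j)
    (hu : ∀ t < r, ∀ i < m, ∀ j < n, H t i j ≤ ((m * n * r : ℕ) : ℤ) - 1)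
    (hinj : ∀ t < r, ∀ i < m, ∀ j < n, ∀ t' < r, ∀ i' < m, ∀ j' < n,
      H t i j = H t' i' j' → t = t' ∧ i = i' ∧ j = j')
    (hr : ∀ t < r, ∀ i < m, ∑ j ∈ range n, H t i j = 0)
    (hc : ∀ t < r, ∀ j < n, ∑ i ∈ range m, H t i j = 0) : MRS m n r := by
  set N := m * n * r with hN
  have key : ∀ t < r, ∀ i < m, ∀ j < n,
      2 * ((((H t i j + N + 1) / 2).toNat : ℕ) : ℤ) = H t i j + (N + 1) := by
    intro t ht i hi j hj
    have := hp t ht i hi j hj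
    have := hl t ht i hi j hj
    omega
  refine ⟨fun t i j => ((H t i j + N + 1) / 2).toNat, ?_, ?_, ?_, ?_⟩
  · intro t i j
    have := hp t t.2 i i.2 j j.2
    have := hl t t.2 i i.2 j j.2
    have := hu t t.2 i i.2 j j.2
    rw [mem_Icc, ← hN]
    clear_value N
    clear hN key
    constructor
    · try dsimp only
      omega
    · try dsimp only
      omega
  · rintro ⟨t, i, j⟩ ⟨t', i', j'⟩ e
    have k1 := key t t.2 i i.2 j j.2
    have k2 := key t' t'.2 i' i'.2 j' j'.2
    dsimp only at e
    rw [e] at k1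
    have := hinj t t.2 i i.2 j j.2 t' t'.2 i' i'.2 j' j'.2 (by linarith)
    simp only [Prod.mk.injEq, Fin.ext_iff]
    exact this
  · intro t i
    rw [← hN]
    zify
    rw [mul_sum]
    rw [sum_congr rfl (fun (j : Fin n) _ => key t t.2 i i.2 j j.2), sum_add_distrib,
      Fin.sum_univ_eq_sum_range (fun j => H t i j) n, hr t t.2 i i.2]
    simp
  · intro t j
    rw [← hN]
    zify
    rw [mul_sum]
    rw [sum_congr rfl (fun (i : Fin m) _ => key t t.2 i i.2 j j.2), sum_add_distrib,
      Fin.sum_univ_eq_sum_range (fun i => H t i j) m, hc t t.2 j j.2]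
    simp

def sgn (i : ℕ) : ℤ := if i % 2 = 0 then 1 else -1

lemma sgn_or (i : ℕ) : sgn i = 1 ∨ sgn i = -1 := by unfold sgn; split_ifs <;> simp

lemma sum3_zero (g : ℕ → ℤ) (Q : ℕ) (h : g 0 + g 1 + g 2 = 0)
    (hg : ∀ q, g (3 + 2 * q) + g (3 + 2 * q + 1) = 0) : ∑ i ∈ range (3 + 2 * Q), g i = 0 := by
  induction Q with
  | zero => simpa [sum_range_succ] using h
  | succ Q ih =>
    rw [show 3 + 2 * (Q + 1) = 3 + 2 * Q + 1 + 1 by ring, sum_range_succ, sum_range_succ, ih]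
    have := hg Q
    linarith

def Bf (κ : ℕ → ℤ) (i j : ℕ) : ℤ :=
  if i < 3 then (if j < 3 then κ ((i + j) % 3) else sgn j * κ i)
  else (if j < 3 then sgn i * κ j else sgn i * sgn j * κ 0)

lemma Bf_symm (κ : ℕ → ℤ) (i j : ℕ) : Bf κ i j = Bf κ j i := by
  unfold Bf
  split_ifs
  · rw [add_comm]
  · rfl
  · rfl
  · ring

lemma sgn_pair (q : ℕ) : sgn (3 + 2 * q + 1) = - sgn (3 + 2 * q) := by
  unfold sgn; split_ifs <;> omega

lemma Bf_sum (κ : ℕ → ℤ) (h : κ 0 + κ 1 + κ 2 = 0) (i Q : ℕ) :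
    ∑ j ∈ range (3 + 2 * Q), Bf κ i j = 0 := by
  apply sum3_zero
  · by_cases hi : i < 3
    · interval_cases i <;> simp [Bf] <;> linarith
    · simp only [Bf, hi, if_false]
      norm_num
      rw [← mul_add, ← mul_add, h, mul_zero]
  · intro q
    simp only [Bf, sgn_pair]
    rw [if_neg (show ¬ (3 + 2 * q < 3) by omega), if_neg (show ¬ (3 + 2 * q + 1 < 3) by omega),
      if_neg (show ¬ (3 + 2 * q < 3) by omega), if_neg (show ¬ (3 + 2 * q + 1 < 3) by omega)]
    split_ifs <;> ring

lemma Bf_form (i j : ℕ) : ∃ s : ℤ, ∃ a : ℕ, (s = 1 ∨ s = -1) ∧ a < 3 ∧ ∀ κ, Bf κ i j = s * κ a := by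
  unfold Bf
  split_ifs with h1 h2 h3
  · exact ⟨1, (i + j) % 3, Or.inl rfl, Nat.mod_lt _ (by norm_num), fun κ => by ring⟩
  · exact ⟨_, i, sgn_or j, h1, fun κ => rfl⟩
  · exact ⟨_, j, sgn_or i, h3, fun κ => rfl⟩
  · refine ⟨_, 0, ?_, by norm_num, fun κ => rfl⟩
    rcases sgn_or i with h | h <;> rcases sgn_or j with h' | h' <;> simp [h, h']

def kot (k t : ℤ) (a : ℕ) : ℤ :=
  if a = 0 then t - k
  else if a = 1 then (if t % 2 = 0 then k - t / 2 else 2 * k - (t - 1) / 2) - k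
  else (if t % 2 = 0 then 2 * k - t / 2 else k - (t + 1) / 2) - k

lemma MRS_odd (m n r : ℕ) (hm : m % 2 = 1) (hn : n % 2 = 1) (hr : r % 2 = 1)
    (hm3 : 3 ≤ m) (hn3 : 3 ≤ n) (hmn : m ≠ n) : MRS m n r := by
  obtain ⟨F, h1, h2, h3, h4⟩ := ZR_odd m n hm hn hm3 hn3 hmn
  obtain ⟨k, rfl⟩ : ∃ k, r = 2 * k + 1 := ⟨r / 2, by omega⟩
  obtain ⟨S, hS⟩ : ∃ S, m * n = 2 * S + 1 := by
    have : (m * n) % 2 = 1 := by rw [Nat.mul_mod, hm, hn]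
    exact ⟨m * n / 2, by omega⟩
  have hN : m * n * (2 * k + 1) = 2 * (S * (2 * k + 1) + k) + 1 := by rw [hS]; ring
  have hsum : ∀ t : ℤ, kot k t 0 + kot k t 1 + kot k t 2 = 0 := by
    intro t; simp only [kot]; norm_num; split_ifs <;> omega
  have hkl : ∀ t : ℕ, t < 2 * k + 1 → ∀ a < 3, -(k : ℤ) ≤ kot k t a ∧ kot k t a ≤ k := by
    intro t ht a ha
    unfold kot
    split_ifs <;> omega
  have hki : ∀ t : ℕ, t < 2 * k + 1 → ∀ t' : ℕ, t' < 2 * k + 1 → ∀ a < 3,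
      kot k t a = kot k t' a → t = t' := by
    intro t ht t' ht' a ha
    unfold kot
    split_ifs <;> omega
  have hB : ∀ t : ℕ, t < 2 * k + 1 → ∀ i j, -(k : ℤ) ≤ Bf (kot k t) i j ∧ Bf (kot k t) i j ≤ k := by
    intro t ht i j
    obtain ⟨s, a, hs, ha, h⟩ := Bf_form i j
    have := hkl t ht a ha
    rw [h]
    rcases hs with rfl | rfl <;> omega
  have hF : ∀ i < m, ∀ j < n, -(S : ℤ) ≤ F i j ∧ F i j ≤ S := by
    intro i hi j hj
    have := h1 i hi j hj
    rw [Set.mem_Iic] at this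
    omega
  apply MRS_of m n (2 * k + 1) (fun t i j => 2 * ((2 * k + 1) * F i j + Bf (kot k t) i j))
  · intro t ht i hi j hj
    rw [hN]; push_cast; omega
  · intro t ht i hi j hj
    have a := hB t ht i j
    have b := hF i hi j hj
    rw [hN]; push_cast
    nlinarith
  · intro t ht i hi j hj
    have a := hB t ht i j
    have b := hF i hi j hj
    rw [hN]; push_cast
    nlinarith
  · intro t ht i hi j hj t' ht' i' hi' j' hj' e
    have a := hB t ht i j
    have a' := hB t' ht' i' j'
    have eF : F i j = F i' j' := by
      rcases lt_trichotomy (F i j) (F i' j') with h | h | h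
      · nlinarith
      · exact h
      · nlinarith
    obtain ⟨rfl, rfl⟩ := h2 i hi j hj i' hi' j' hj' eF
    refine ⟨?_, rfl, rfl⟩
    obtain ⟨s, a, hs, ha, h⟩ := Bf_form i j
    apply hki t ht t' ht' a ha
    simp only [h] at e
    rcases hs with rfl | rfl <;> linarith
  · intro t ht i hi
    obtain ⟨Q, rfl⟩ : ∃ Q, n = 3 + 2 * Q := ⟨(n - 3) / 2, by omega⟩
    rw [← mul_sum, sum_add_distrib, ← mul_sum, h3 i hi, Bf_sum _ (hsum t)]
    simp
  · intro t ht j hj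
    obtain ⟨Q, rfl⟩ : ∃ Q, m = 3 + 2 * Q := ⟨(m - 3) / 2, by omega⟩
    simp only [Bf_symm _ _ j]
    rw [← mul_sum, sum_add_distrib, ← mul_sum, h4 j hj, Bf_sum _ (hsum t)]
    simp

lemma MRS_even_of (M n r : ℕ) (σ : ℕ → ℤ) (w : ℕ → ℕ → ℕ) (hσ : ∀ j, σ j = 1 ∨ σ j = -1)
    (hw : ∀ j, ∀ s < r * M, w j s < r * M)
    (hwi : ∀ j, ∀ s < r * M, ∀ s' < r * M, w j s = w j s' → s = s')
    (hs : ∀ s < r * M, ∑ j ∈ range n, σ j * (2 * ((j : ℤ) * (r * M : ℕ) + w j s) + 1) = 0) :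
    MRS (2 * M) n r := by
  have hN : 2 * M * n * r = 2 * (n * (r * M)) := by ring
  have hst : ∀ t < r, ∀ i < 2 * M, t * M + i / 2 < r * M := by
    intro t ht i hi
    have : i / 2 < M := by omega
    nlinarith
  set R := r * M with hR
  have hab : ∀ t i j, (sgn i * σ j * (2 * ((j : ℤ) * R + w j (t * M + i / 2)) + 1)).natAbs
      = 2 * (j * R + w j (t * M + i / 2)) + 1 := by
    intro t i j
    rw [Int.natAbs_mul, Int.natAbs_mul]
    have e1 : (sgn i).natAbs = 1 := by rcases sgn_or i with h | h <;> rw [h] <;> rfl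
    have e2 : (σ j).natAbs = 1 := by rcases hσ j with h | h <;> rw [h] <;> rfl
    rw [e1, e2, one_mul, one_mul]
    norm_cast
  have hbd : ∀ t < r, ∀ i < 2 * M, ∀ j < n, j * R + w j (t * M + i / 2) < n * R := by
    intro t ht i hi j hj
    have := hw j _ (hst t ht i hi)
    nlinarith
  apply MRS_of (2 * M) n r (fun t i j => sgn i * σ j * (2 * ((j : ℤ) * R + w j (t * M + i / 2)) + 1))
  · intro t ht i hi j hj
    have := hab t i j
    rw [hN]
    omega
  · intro t ht i hi j hj
    have := hab t i j
    have := hbd t ht i hi j hj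
    rw [hN]
    omega
  · intro t ht i hi j hj
    have := hab t i j
    have := hbd t ht i hi j hj
    rw [hN]
    omega
  · intro t ht i hi j hj t' ht' i' hi' j' hj' e
    have e1 := congrArg Int.natAbs e
    rw [hab, hab] at e1
    have w1 := hw j _ (hst t ht i hi)
    have w2 := hw j' _ (hst t' ht' i' hi')
    have ej : j = j' := by
      rcases lt_trichotomy j j' with h | h | h
      · nlinarith
      · exact h
      · nlinarith
    subst ej
    have e2 := hwi j _ (hst t ht i hi) _ (hst t' ht' i' hi') (by omega)
    have b1 : i / 2 < M := by omega
    have b2 : i' / 2 < M := by omega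
    have et : t = t' := by
      rcases lt_trichotomy t t' with h | h | h
      · have := Nat.mul_le_mul_right M (Nat.succ_le_of_lt h)
        rw [Nat.succ_mul] at this
        omega
      · exact h
      · have := Nat.mul_le_mul_right M (Nat.succ_le_of_lt h)
        rw [Nat.succ_mul] at this
        omega
    subst et
    have e3 : i / 2 = i' / 2 := by omega
    rw [e3] at e
    have hne : (2 * ((j : ℤ) * R + w j (t * M + i' / 2)) + 1) ≠ 0 := by positivity
    have e4 := mul_right_cancel₀ hne e
    have hne' : σ j ≠ 0 := by rcases hσ j with h | h <;> rw [h] <;> norm_num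
    have e5 := mul_right_cancel₀ hne' e4
    refine ⟨rfl, ?_, rfl⟩
    unfold sgn at e5
    split_ifs at e5 <;> omega
  · intro t ht i hi
    simp only [mul_assoc (sgn i)]
    rw [← mul_sum, hs _ (hst t ht i hi), mul_zero]
  · intro t ht j hj
    clear hst hbd hw hwi hs hN hR
    clear_value R
    generalize w j = v
    have : ∀ Q : ℕ, ∑ i ∈ range (2 * Q), sgn i * σ j * (2 * ((j : ℤ) * R + v (t * M + i / 2)) + 1) = 0 := by
      intro Q
      induction Q with
      | zero => simp
      | succ Q ih =>
        rw [show 2 * (Q + 1) = 2 * Q + 1 + 1 by ring, sum_range_succ, sum_range_succ, ih]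
        have s1 : sgn (2 * Q) = 1 := by unfold sgn; split_ifs <;> omega
        have s2 : sgn (2 * Q + 1) = -1 := by unfold sgn; split_ifs <;> omega
        rw [s1, s2, show (2 * Q + 1) / 2 = Q by omega, show (2 * Q) / 2 = Q by omega]
        ring
    exact this M

lemma MRS_even4 (M a r : ℕ) : MRS (2 * M) (4 * a) r := by
  apply MRS_even_of M (4 * a) r (fun j => if j % 4 = 0 ∨ j % 4 = 3 then 1 else -1) (fun _ s => s)
  · intro j; split_ifs <;> simp
  · intro j s hs; exact hs
  · intro j s hs s' hs' h; exact h
  · intro s hs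
    clear hs
    generalize r * M = R
    induction a with
    | zero => simp
    | succ a ih =>
      rw [show 4 * (a + 1) = 4 * a + 1 + 1 + 1 + 1 by ring, sum_range_succ, sum_range_succ,
        sum_range_succ, sum_range_succ, ih]
      rw [if_pos (by omega), if_neg (by omega), if_neg (by omega), if_pos (by omega)]
      push_cast
      ring

lemma MRS_even6 (M a r : ℕ) : MRS (2 * M) (6 + 4 * a) r := by
  apply MRS_even_of M (6 + 4 * a) r
    (fun j => if j = 3 ∨ j = 5 ∨ (6 ≤ j ∧ (j % 4 = 2 ∨ j % 4 = 1)) then 1 else -1)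
    (fun j s => if j = 0 then r * M - 1 - s else s)
  · intro j; split_ifs <;> simp
  · intro j s hs; split_ifs <;> omega
  · intro j s hs s' hs'; split_ifs <;> omega
  · intro s hs
    generalize r * M = R at *
    induction a with
    | zero =>
      simp [sum_range_succ]
      omega
    | succ a ih =>
      rw [show 6 + 4 * (a + 1) = 6 + 4 * a + 1 + 1 + 1 + 1 by ring, sum_range_succ, sum_range_succ,
        sum_range_succ, sum_range_succ, ih]
      rw [if_pos (by omega), if_neg (by omega), if_neg (by omega), if_neg (by omega),
        if_neg (by omega), if_neg (by omega), if_pos (by omega), if_neg (by omega)]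
      push_cast
      ring

lemma MRS_even' (m n r : ℕ) (hm : m % 2 = 0) (hn : n % 2 = 0) (h4 : 4 ≤ n) : MRS m n r := by
  obtain ⟨M, rfl⟩ : ∃ M, m = 2 * M := ⟨m / 2, by omega⟩
  by_cases h : n % 4 = 0
  · obtain ⟨a, rfl⟩ : ∃ a, n = 4 * a := ⟨n / 4, by omega⟩
    exact MRS_even4 M a r
  · obtain ⟨a, rfl⟩ : ∃ a, n = 6 + 4 * a := ⟨(n - 6) / 4, by omega⟩
    exact MRS_even6 M a r

lemma MRS_even (m n r : ℕ) (hm : m % 2 = 0) (hn : n % 2 = 0) (hm1 : 1 < m) (hn1 : 1 < n)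
    (hmn : m ≠ n) : MRS m n r := by
  by_cases h : 4 ≤ n
  · exact MRS_even' m n r hm hn h
  · exact (MRS_even' n m r hn hm (by omega)).transp

lemma part_one (m n r : ℕ) (hm : 1 < m) (hn : 1 < n) (hmn : m ≠ n) (hr : 1 ≤ r)
    (F : Fin r → Fin m → Fin n → ℕ)
    (h3 : ∀ t i, 2 * ∑ j, F t i j = n * (m * n * r + 1))
    (h4 : ∀ t j, 2 * ∑ i, F t i j = m * (m * n * r + 1)) :
    ((∀ t i j, (∑ j', F t i j') ≠ (∑ i', F t i' j)) ∧
        (Finset.image (fun p : Fin r × Fin m => ∑ j', F p.1 p.2 j') Finset.univ ∪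
         Finset.image (fun p : Fin r × Fin n => ∑ i', F p.1 i' p.2) Finset.univ).card = 2) := by
  have hne : ∀ t i j, (∑ j', F t i j') ≠ (∑ i', F t i' j) := by
    intro t i j e
    have a := h3 t i
    rw [e, h4 t j] at a
    exact hmn (Nat.eq_of_mul_eq_mul_right (Nat.succ_pos _) a)
  refine ⟨hne, ?_⟩
  let t0 : Fin r := ⟨0, by omega⟩
  let i0 : Fin m := ⟨0, by omega⟩
  let j0 : Fin n := ⟨0, by omega⟩
  have e1 : Finset.image (fun p : Fin r × Fin m => ∑ j', F p.1 p.2 j') Finset.univ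
      = {∑ j', F t0 i0 j'} := by
    ext x
    simp only [mem_image, mem_univ, true_and, mem_singleton]
    constructor
    · rintro ⟨p, rfl⟩
      have a := h3 p.1 p.2
      have b := h3 t0 i0
      omega
    · rintro rfl; exact ⟨(t0, i0), rfl⟩
  have e2 : Finset.image (fun p : Fin r × Fin n => ∑ i', F p.1 i' p.2) Finset.univ
      = {∑ i', F t0 i' j0} := by
    ext x
    simp only [mem_image, mem_univ, true_and, mem_singleton]
    constructor
    · rintro ⟨p, rfl⟩
      have a := h4 p.1 p.2
      have b := h4 t0 j0
      omega
    · rintro rfl; exact ⟨(t0, j0), rfl⟩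
  rw [e1, e2, ← insert_eq, card_pair (hne t0 i0 j0)]


/-- Labeling the `t`-th copy of `K_{m,n}` (`m ≠ n`, `m, n > 1`) by the `t`-th array of a
magic rectangle set `MRS(m,n;r)` is a local antimagic labeling inducing exactly 2 weights;
hence `χ_la(rK_{m,n}) = 2` whenever `m, n, r` are all odd, or `m, n` are both even with
`(m,n) ≠ (2,2)`.  The edges of `rK_{m,n}` are indexed by `Fin r × Fin m × Fin n`; the
weight of the `i`-th `m`-part vertex of copy `t` is the `i`-th row sum of the `t`-th array
and similarly for the `n`-part. -/
theorem stmt_19 (m n r : ℕ) (hm : 1 < m) (hn : 1 < n) (hmn : m ≠ n) (hr : 1 ≤ r) :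
    (∀ F : Fin r → Fin m → Fin n → ℕ,
      (∀ t i j, F t i j ∈ Finset.Icc 1 (m * n * r)) →
      Function.Injective (fun p : Fin r × Fin m × Fin n => F p.1 p.2.1 p.2.2) →
      (∀ t i, 2 * ∑ j, F t i j = n * (m * n * r + 1)) →
      (∀ t j, 2 * ∑ i, F t i j = m * (m * n * r + 1)) →
      ((∀ t i j, (∑ j', F t i j') ≠ (∑ i', F t i' j)) ∧
        (Finset.image (fun p : Fin r × Fin m => ∑ j', F p.1 p.2 j') Finset.univ ∪
         Finset.image (fun p : Fin r × Fin n => ∑ i', F p.1 i' p.2) Finset.univ).card = 2)) ∧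
    ((Odd m ∧ Odd n ∧ Odd r) ∨ (Even m ∧ Even n ∧ ¬(m = 2 ∧ n = 2)) →
      (∃ F : Fin r → Fin m → Fin n → ℕ,
        (∀ t i j, F t i j ∈ Finset.Icc 1 (m * n * r)) ∧
        Function.Injective (fun p : Fin r × Fin m × Fin n => F p.1 p.2.1 p.2.2) ∧
        (∀ t i j, (∑ j', F t i j') ≠ (∑ i', F t i' j)) ∧
        (Finset.image (fun p : Fin r × Fin m => ∑ j', F p.1 p.2 j') Finset.univ ∪
         Finset.image (fun p : Fin r × Fin n => ∑ i', F p.1 i' p.2) Finset.univ).card = 2) ∧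
      (∀ F : Fin r → Fin m → Fin n → ℕ,
        (∀ t i j, F t i j ∈ Finset.Icc 1 (m * n * r)) →
        Function.Injective (fun p : Fin r × Fin m × Fin n => F p.1 p.2.1 p.2.2) →
        (∀ t i j, (∑ j', F t i j') ≠ (∑ i', F t i' j)) →
        2 ≤ (Finset.image (fun p : Fin r × Fin m => ∑ j', F p.1 p.2 j') Finset.univ ∪
             Finset.image (fun p : Fin r × Fin n => ∑ i', F p.1 i' p.2) Finset.univ).card)) := by

  refine ⟨fun F _ _ h3 h4 => part_one m n r hm hn hmn hr F h3 h4, ?_⟩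
  intro h
  constructor
  · have hM : MRS m n r := by
      rcases h with ⟨h1, h2, h3⟩ | ⟨h1, h2, _⟩
      · rw [Nat.odd_iff] at h1 h2 h3
        exact MRS_odd m n r h1 h2 h3 (by omega) (by omega) hmn
      · rw [Nat.even_iff] at h1 h2
        exact MRS_even m n r h1 h2 hm hn hmn
    obtain ⟨F, h1, h2, h3, h4⟩ := hM
    have := part_one m n r hm hn hmn hr F h3 h4
    exact ⟨F, h1, h2, this.1, this.2⟩
  · intro F _ _ hne
    have := hne ⟨0, by omega⟩ ⟨0, by omega⟩ ⟨0, by omega⟩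
    rw [← card_pair this]
    apply card_le_card
    intro x hx
    rw [mem_insert, mem_singleton] at hx
    rw [mem_union, mem_image, mem_image]
    rcases hx with rfl | rfl
    · exact Or.inl ⟨(⟨0, by omega⟩, ⟨0, by omega⟩), mem_univ _, rfl⟩
    · exact Or.inr ⟨(⟨0, by omega⟩, ⟨0, by omega⟩), mem_univ _, rfl⟩
end
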